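/- arXiv:1104.2099 — 5 statements merged into one kernel-verified Lean document; each statement's English description precedes it below -/
import Mathlib

section
/- Let 1 ≤ s < t be integers with t ≥ 2s+1, let α = (1/(32t(s+t)))³, and let k be a sufficiently large integer with n = (2k+1)(s+t). Let F[A,B] be a bipartite graph with |A| = k(s+t) + z and |B| = k(s+t) + y where z and y are integers with |z|, |y| ≤ α^{2/3} n/2, y ≥ z and y ≥ (t+1)/2. Suppose every vertex of A has at least y + s − t/2 − 1 neighbors in B and every vertex of B has at most α^{1/3} n neighbors in A. Then F contains y pairwise vertex-disjoint s-stars with centers in a set C_B ⊆ B and leaves in a set L_A ⊆ A; furthermore, if z ≥ 1, then F also contains z pairwise vertex-disjoint s-stars with centers in A∖L_A and leaves in B∖C_B. -/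
open scoped Classical
open Finset

namespace PaperTiling

variable {V : Type*} [Fintype V] [DecidableEq V]

/-- The number of neighbours of `v` inside the set `S`. -/
noncomputable def degS (G : SimpleGraph V) (v : V) (S : Finset V) : ℕ :=
  (S.filter fun w => G.Adj v w).card

/-- The number of edges of `G` with one end in `A` and the other in `B`. -/
noncomputable def eAB (G : SimpleGraph V) (A B : Finset V) : ℕ :=
  ∑ v ∈ A, degS G v B

/-- The edge density `d(A,B) = e(A,B)/(|A||B|)`. -/
noncomputable def dens (G : SimpleGraph V) (A B : Finset V) : ℝ :=
  (eAB G A B : ℝ) / ((A.card : ℝ) * (B.card : ℝ))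

/-- `G` is a bipartite graph with parts `A` and `B`. -/
def IsBipartition (G : SimpleGraph V) (A B : Finset V) : Prop :=
  Disjoint A B ∧ A ∪ B = Finset.univ ∧
    ∀ u v : V, G.Adj u v → (u ∈ A ∧ v ∈ B) ∨ (u ∈ B ∧ v ∈ A)

/-- `(S, T)` spans a copy of the complete bipartite graph `K_{s,t}` in `G`,
with `S` the side of size `s` and `T` the side of size `t`. -/
def IsKst (G : SimpleGraph V) (s t : ℕ) (S T : Finset V) : Prop :=
  Disjoint S T ∧ S.card = s ∧ T.card = t ∧ ∀ u ∈ S, ∀ v ∈ T, G.Adj u v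

/-- `𝒯` is a perfect `K_{s,t}`-tiling of `G`: a collection of pairwise
vertex-disjoint copies of `K_{s,t}` covering all vertices. -/
def IsKstTiling (G : SimpleGraph V) (s t : ℕ)
    (𝒯 : Finset (Finset V × Finset V)) : Prop :=
  (∀ P ∈ 𝒯, IsKst G s t P.1 P.2) ∧
  (𝒯 : Set (Finset V × Finset V)).PairwiseDisjoint (fun P => P.1 ∪ P.2) ∧
  𝒯.sup (fun P => P.1 ∪ P.2) = Finset.univ

/-- `G` can be tiled with `K_{s,t}`. -/
def KstTileable (G : SimpleGraph V) (s t : ℕ) : Prop :=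
  ∃ 𝒯 : Finset (Finset V × Finset V), IsKstTiling G s t 𝒯

/-- `G` can be tiled with the complete graph `K_s`. -/
def CliqueTileable (G : SimpleGraph V) (s : ℕ) : Prop :=
  ∃ 𝒞 : Finset (Finset V),
    (∀ S ∈ 𝒞, S.card = s ∧ G.IsClique (S : Set V)) ∧
    (𝒞 : Set (Finset V)).PairwiseDisjoint id ∧
    𝒞.sup id = Finset.univ

/-- The minimum degree of `G` equals the real number `c`. -/
def MinDegreeIs (G : SimpleGraph V) (c : ℝ) : Prop :=
  (∀ v : V, c ≤ (degS G v Finset.univ : ℝ)) ∧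
  ∃ v : V, (degS G v Finset.univ : ℝ) = c

/-- `(c, L)` is an `h`-star with centre `c ∈ A` and `h` leaves `L ⊆ B`. -/
def IsStar (G : SimpleGraph V) (h : ℕ) (A B : Finset V) (c : V) (L : Finset V) : Prop :=
  c ∈ A ∧ L ⊆ B ∧ L.card = h ∧ ∀ v ∈ L, G.Adj c v

/-- `𝒮` is a family of pairwise vertex-disjoint `h`-stars from `A` to `B`. -/
def StarFamily (G : SimpleGraph V) (h : ℕ) (A B : Finset V)
    (𝒮 : Finset (V × Finset V)) : Prop :=
  (∀ S ∈ 𝒮, IsStar G h A B S.1 S.2) ∧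
  (𝒮 : Set (V × Finset V)).PairwiseDisjoint (fun S => insert S.1 S.2)

/-- The structure hypotheses (H) for the extremal construction of the paper:
`1 ≤ s < t`, `t ≥ 2s+1`, `k ≥ 1`, `G` is bipartite with parts
`U₀ ∪ U₁ ∪ U₂` and `V₀ ∪ V₁ ∪ V₂`, with the prescribed part sizes,
complete pairs `(U₁,V₁)`, `(U₂,V₂)`, `(U₀, V₁∪V₂)`, `(V₀, U₁∪U₂)`,
no edges between `U₀` and `V₀`, and sparse `K_{2,2}`-free diagonal pairs. -/
structure StructH (G : SimpleGraph V) (s t k : ℕ)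
    (U0 U1 U2 V0 V1 V2 : Finset V) : Prop where
  hs : 1 ≤ s
  hst : s < t
  ht : 2 * s + 1 ≤ t
  hk : 1 ≤ k
  bip : IsBipartition G (U0 ∪ U1 ∪ U2) (V0 ∪ V1 ∪ V2)
  hU01 : Disjoint U0 U1
  hU02 : Disjoint U0 U2
  hU12 : Disjoint U1 U2
  hV01 : Disjoint V0 V1
  hV02 : Disjoint V0 V2
  hV12 : Disjoint V1 V2
  cardU0 : U0.card = s - 1
  cardV0 : V0.card = s - 1
  cardU1 : U1.card = k * (s + t) + (t + 1) / 2
  cardV2 : V2.card = k * (s + t) + (t + 1) / 2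
  cardV1 : V1.card = k * (s + t) + (t + 2) / 2
  cardU2 : U2.card = k * (s + t) + (t + 2) / 2
  compU1V1 : ∀ u ∈ U1, ∀ v ∈ V1, G.Adj u v
  compU2V2 : ∀ u ∈ U2, ∀ v ∈ V2, G.Adj u v
  compU0 : ∀ u ∈ U0, ∀ v ∈ V1 ∪ V2, G.Adj u v
  compV0 : ∀ v ∈ V0, ∀ u ∈ U1 ∪ U2, G.Adj u v
  emptyU0V0 : ∀ u ∈ U0, ∀ v ∈ V0, ¬ G.Adj u v
  K22freeU1V2 : ∀ S T : Finset V, S ⊆ U1 → T ⊆ V2 → ¬ IsKst G 2 2 S T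
  K22freeU2V1 : ∀ S T : Finset V, S ⊆ U2 → T ⊆ V1 → ¬ IsKst G 2 2 S T
  degU1 : ∀ u ∈ U1, degS G u V2 ≤ s - 1
  degU2 : ∀ u ∈ U2, degS G u V1 ≤ s - 1
  degV1 : ∀ v ∈ V1, degS G v U2 ≤ s - 1
  degV2 : ∀ v ∈ V2, degS G v U1 ≤ s - 1

/-- The vertex set `W` of a copy of `K_{s,t}` is crossing. -/
def Crossing (U1 V1 U2 V2 W : Finset V) : Prop :=
  (W ∩ (U1 ∪ V1)).Nonempty ∧ (W ∩ (U2 ∪ V2)).Nonempty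

/-- `W` is crossing from the set `A`, where `AD = A^D` is the diagonal set of `A`
and `AM = A^M` is the opposite middle set of `A`. -/
def CrossingFrom (W A AD AM : Finset V) : Prop :=
  (W ∩ A).card = 1 ∧
    (2 ≤ (W ∩ AD).card ∨ ((W ∩ AD).card = 1 ∧ (W ∩ AM).Nonempty))

/-- `W` is of Type 1 (crossing from `A`), where `AD = A^D`, `AN = A^N`,
`ANM = (A^N)^M`. -/
def Type1From (s t : ℕ) (W AD AN ANM : Finset V) : Prop :=
  ∃ p : ℕ, 2 ≤ p ∧ p ≤ s - 1 ∧ (W ∩ ANM).card = s - 1 ∧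
    (W ∩ AN).card = t - p ∧ (W ∩ AD).card = p

/-- `W` is of Type 2 (crossing from `A`), where `AD = A^D`, `AM = A^M`,
`AND = (A^N)^D`. -/
def Type2From (s t : ℕ) (W AD AM AND : Finset V) : Prop :=
  ∃ p : ℕ, 1 ≤ p ∧ p ≤ s - 1 ∧ (W ∩ AND).card = t - 1 ∧
    (W ∩ AM).card = s - p ∧ (W ∩ AD).card = p

/-- A greedy construction of `m` disjoint `h`-stars from `A` to `B`. -/
theorem exists_starFamily_of_forall_card_lt {ι : Type*} [DecidableEq ι]
    (G : SimpleGraph ι) (h m : ℕ) (A B : Finset ι)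
    (H : ∀ W : Finset ι, W.card < m * (h + 1) → ∃ a ∈ A \ W, h ≤ degS G a (B \ W)) :
    ∃ 𝒮 : Finset (ι × Finset ι), StarFamily G h A B 𝒮 ∧ 𝒮.card = m := by
  suffices ∀ j ≤ m, ∃ 𝒮 : Finset (ι × Finset ι), StarFamily G h A B 𝒮 ∧ 𝒮.card = j from
    this m le_rfl
  intro j
  induction j with
  | zero => exact fun _ => ⟨∅, ⟨by simp, by simp⟩, rfl⟩
  | succ j ih =>
    intro hj
    obtain ⟨𝒮, ⟨hstar, hdisj⟩, hcard⟩ := ih (by omega)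
    set W := 𝒮.biUnion fun S => insert S.1 S.2 with hW
    have hWcard : W.card ≤ j * (h + 1) := by
      rw [← hcard]
      refine card_biUnion_le_card_mul _ _ _ fun S hS => ?_
      rw [← (hstar S hS).2.2.1]
      exact card_insert_le _ _
    obtain ⟨a, ha, hdeg⟩ := H W (by nlinarith)
    obtain ⟨L, hL, hLcard⟩ := exists_subset_card_eq hdeg
    rw [mem_sdiff] at ha
    have hLmem : ∀ v ∈ L, (v ∈ B ∧ v ∉ W) ∧ G.Adj a v := fun v hv => by
      simpa using hL hv
    have hnew : ∀ S ∈ 𝒮, Disjoint (insert a L) (insert S.1 S.2) := by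
      intro S hS
      have hsub : insert S.1 S.2 ⊆ W := subset_biUnion_of_mem (fun S => insert S.1 S.2) hS
      refine Disjoint.mono_right hsub ?_
      rw [disjoint_insert_left, disjoint_left]
      exact ⟨ha.2, fun v hv => (hLmem v hv).1.2⟩
    have hnot : (a, L) ∉ 𝒮 := fun hmem =>
      ha.2 (mem_biUnion.2 ⟨(a, L), hmem, mem_insert_self _ _⟩)
    refine ⟨cons (a, L) 𝒮 hnot, ⟨?_, ?_⟩, by rw [card_cons, hcard]⟩
    · intro S hS
      rcases mem_cons.1 hS with rfl | hS
      · exact ⟨ha.1, fun v hv => (hLmem v hv).1.1, hLcard, fun v hv => (hLmem v hv).2⟩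
      · exact hstar S hS
    · rw [coe_cons]
      exact hdisj.insert fun S hS _ => hnew S hS

theorem sum_degS_comm {ι : Type*} (G : SimpleGraph ι) (X Y : Finset ι) :
    ∑ a ∈ X, degS G a Y = ∑ b ∈ Y, degS G b X := by
  simp only [degS, card_filter]
  rw [sum_comm]
  simp only [G.adj_comm]

theorem degS_mono {ι : Type*} (G : SimpleGraph ι) (v : ι) {X Y : Finset ι} (h : X ⊆ Y) :
    degS G v X ≤ degS G v Y :=
  card_le_card (filter_subset_filter _ h)

/-- Removing a set `U` from `B` destroys at most `|U| * Δ` edges between `X ⊆ A` and `B`, when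
every vertex of `B` has at most `Δ` neighbours in `A`. -/
theorem sum_degS_le_sum_sdiff_add {ι : Type*} [DecidableEq ι] (G : SimpleGraph ι)
    {A B X U : Finset ι} {Δ : ℝ} (hΔ : 0 ≤ Δ) (hX : X ⊆ A)
    (hB : ∀ b ∈ B, (degS G b A : ℝ) ≤ Δ) :
    (∑ a ∈ X, (degS G a B : ℝ)) ≤ ∑ a ∈ X, (degS G a (B \ U) : ℝ) + U.card * Δ := by
  have hsplit : ∀ a, degS G a B = degS G a (B \ U) + degS G a (B ∩ U) := by
    intro a
    simp only [degS, card_filter]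
    rw [add_comm, sum_inter_add_sum_sdiff]
  have hinter : (∑ a ∈ X, (degS G a (B ∩ U) : ℝ)) ≤ U.card * Δ := by
    calc (∑ a ∈ X, (degS G a (B ∩ U) : ℝ)) = ∑ b ∈ B ∩ U, (degS G b X : ℝ) := by
          exact_mod_cast sum_degS_comm G X (B ∩ U)
      _ ≤ ∑ b ∈ B ∩ U, Δ := sum_le_sum fun b hb =>
          le_trans (by exact_mod_cast degS_mono G b hX) (hB b (mem_inter.1 hb).1)
      _ = (B ∩ U).card * Δ := by rw [sum_const, nsmul_eq_mul]
      _ ≤ U.card * Δ := by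
          gcongr
          exact inter_subset_right
  simp only [hsplit, Nat.cast_add, sum_add_distrib]
  linarith

/-- The inequality behind the greedy choice of stars centred in `B`. -/
theorem star_count_from_right {s t n a b y β : ℝ} (hs : 1 ≤ s) (ht : 2 * s + 1 ≤ t)
    (hβ : β = 1 / (32 * t * (s + t))) (hn : 0 < n) (ha : n / 4 ≤ a)
    (hb : b ≤ a + β ^ 2 * n) (hy : y ≤ β ^ 2 * n / 2) (hyt : (t + 1) / 2 ≤ y) :
    (s - 1) * b + (s + 1) * y * (β * n) < (a - (s + 1) * y) * (y + s - t / 2 - 1) := by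
  have hs0 : 0 < s := by linarith
  have ht0 : 0 < t := by linarith
  have hβ0 : 0 < β := by rw [hβ]; positivity
  have hβe : β * (32 * t * (s + t)) = 1 := by rw [hβ]; field_simp
  have hst : (s + 1) * (t + 1) * β ≤ 1 / 16 := by
    have : (s + 1) * (t + 1) ≤ (s + t) * (2 * t) := by gcongr <;> linarith
    nlinarith
  have hsβ : 2 * (s - 1) * β ≤ 1 / 16 := by nlinarith
  have hβs : β ≤ 1 / 32 := by
    have : 1 * 1 ≤ t * (s + t) := by gcongr <;> linarith
    nlinarith
  set e := y - t / 2 with he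
  have he2 : 1 / 2 ≤ e := by linarith
  have hye : y ≤ (t + 1) * e := by nlinarith
  have h1 : (s + 1) * y * (y + s - t / 2 - 1) ≤ 1 / 16 * (n * e) := by
    calc (s + 1) * y * (y + s - t / 2 - 1) ≤ (s + 1) * ((t + 1) * e) * (β ^ 2 * n) := by
          gcongr <;> nlinarith
      _ = ((s + 1) * (t + 1) * β) * β * (n * e) := by ring
      _ ≤ 1 / 16 * 1 * (n * e) := by gcongr; linarith
      _ = 1 / 16 * (n * e) := by ring
  have h2 : (s - 1) * (β ^ 2 * n) ≤ 1 / 32 * (n * e) := by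
    calc (s - 1) * (β ^ 2 * n) = (2 * (s - 1) * β) * β * (n * (1 / 2)) := by ring
      _ ≤ 1 / 16 * (1 / 32) * (n * e) := by gcongr
      _ ≤ 1 / 32 * (n * e) := by gcongr; norm_num
  have h3 : (s + 1) * y * (β * n) ≤ 1 / 16 * (n * e) := by
    calc (s + 1) * y * (β * n) ≤ (s + 1) * ((t + 1) * e) * (β * n) := by gcongr
      _ = ((s + 1) * (t + 1) * β) * (n * e) := by ring
      _ ≤ 1 / 16 * (n * e) := by gcongr
  have h4 : n / 4 * e ≤ a * e := by gcongr
  have h5 : (s - 1) * b ≤ (s - 1) * (a + β ^ 2 * n) := by gcongr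
  have h6 : 0 < n * e := by positivity
  have h7 : (a - (s + 1) * y) * (y + s - t / 2 - 1)
      = a * e + (s - 1) * a - (s + 1) * y * (y + s - t / 2 - 1) := by rw [he]; ring
  linarith

/-- The inequality behind the greedy choice of stars centred in `A`. -/
theorem star_count_from_left {s t n a y β : ℝ} (hs : 1 ≤ s) (ht : 2 * s + 1 ≤ t)
    (hβ : β = 1 / (32 * t * (s + t))) (hn : 0 < n) (ha : n / 4 ≤ a)
    (hy : y ≤ β ^ 2 * n / 2) (hyt : (t + 1) / 2 ≤ y) :
    (s + 2) * y * (β * n) < (a - (2 * s + 1) * y) * (y - t / 2) := by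
  have hs0 : 0 < s := by linarith
  have ht0 : 0 < t := by linarith
  have hβ0 : 0 < β := by rw [hβ]; positivity
  have hβe : β * (32 * t * (s + t)) = 1 := by rw [hβ]; field_simp
  have hst : (s + 2) * (t + 1) * β ≤ 1 / 16 := by
    have : (s + 2) * (t + 1) ≤ (s + t) * (2 * t) := by gcongr <;> linarith
    nlinarith
  have hsβ : (2 * s + 1) * β ≤ 1 / 16 := by nlinarith
  have hβs : β ≤ 1 / 32 := by
    have : 1 * 1 ≤ t * (s + t) := by gcongr <;> linarith
    nlinarith
  set e := y - t / 2 with he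
  have he2 : 1 / 2 ≤ e := by linarith
  have hye : y ≤ (t + 1) * e := by nlinarith
  have h1 : (2 * s + 1) * y ≤ 1 / 16 * n := by
    calc (2 * s + 1) * y ≤ (2 * s + 1) * (β ^ 2 * n / 2) := by gcongr
      _ = ((2 * s + 1) * β) * (β / 2) * n := by ring
      _ ≤ 1 / 16 * 1 * n := by gcongr; linarith
      _ = 1 / 16 * n := by ring
  have h3 : (s + 2) * y * (β * n) ≤ 1 / 16 * (n * e) := by
    calc (s + 2) * y * (β * n) ≤ (s + 2) * ((t + 1) * e) * (β * n) := by gcongr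
      _ = ((s + 2) * (t + 1) * β) * (n * e) := by ring
      _ ≤ 1 / 16 * (n * e) := by gcongr
  have h4 : (n / 4 - 1 / 16 * n) * e ≤ (a - (2 * s + 1) * y) * e := by gcongr
  have h6 : 0 < n * e := by positivity
  linarith

/-- Claim 2.5, Stars: with `α = (1/(32t(s+t)))³`, `k`
sufficiently large, `n = (2k+1)(s+t)`, `|A| = k(s+t)+z`, `|B| = k(s+t)+y`
(`|z|,|y| ≤ α^{2/3}n/2`, `z ≤ y`, `y ≥ (t+1)/2`), minimum degree from `A`
to `B` at least `y+s−t/2−1` and maximum degree from `B` to `A` at most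
`α^{1/3}n`, there are `y` disjoint `s`-stars from `B` to `A`; and if
`z ≥ 1`, also `z` disjoint `s`-stars from the unused part of `A` to the
unused part of `B`. -/
theorem claim_stars (s t : ℕ) (hs : 1 ≤ s) (hst : s < t) (ht : 2 * s + 1 ≤ t)
    (α : ℝ) (hα : α = (1 / (32 * (t : ℝ) * ((s : ℝ) + (t : ℝ)))) ^ 3) :
    ∃ k₀ : ℕ, ∀ k : ℕ, k₀ ≤ k → ∀ n : ℕ, n = (2 * k + 1) * (s + t) →
    ∀ (V : Type) (_ : Fintype V) (_ : DecidableEq V),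
    ∀ (F : SimpleGraph V) (A B : Finset V) (z y : ℤ),
      (A.card : ℤ) = (k : ℤ) * ((s : ℤ) + t) + z →
      (B.card : ℤ) = (k : ℤ) * ((s : ℤ) + t) + y →
      |(z : ℝ)| ≤ α ^ ((2 : ℝ) / 3) * n / 2 →
      |(y : ℝ)| ≤ α ^ ((2 : ℝ) / 3) * n / 2 →
      z ≤ y → ((t : ℝ) + 1) / 2 ≤ (y : ℝ) →
      (∀ v ∈ A, (y : ℝ) + s - (t : ℝ) / 2 - 1 ≤ (degS F v B : ℝ)) →
      (∀ v ∈ B, (degS F v A : ℝ) ≤ α ^ ((1 : ℝ) / 3) * n) →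
      ∃ 𝒮 : Finset (V × Finset V), StarFamily F s B A 𝒮 ∧ (𝒮.card : ℤ) = y ∧
        (1 ≤ z →
          ∃ 𝒮' : Finset (V × Finset V),
            StarFamily F s (A \ 𝒮.biUnion (fun S => S.2))
              (B \ 𝒮.image Prod.fst) 𝒮' ∧
            (𝒮'.card : ℤ) = z) := by
  refine ⟨2, ?_⟩
  intro k hk n hn V _ _ F A B z y hA hB hz hy hzy hyt hdA hdB
  set β : ℝ := 1 / (32 * (t : ℝ) * ((s : ℝ) + (t : ℝ))) with hβ
  have hs1 : (1 : ℝ) ≤ s := by exact_mod_cast hs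
  have ht1 : 2 * (s : ℝ) + 1 ≤ t := by exact_mod_cast ht
  have hs0 : (0 : ℝ) < s := by linarith
  have ht0 : (0 : ℝ) < t := by linarith
  have hβ0 : 0 < β := by positivity
  have hα1 : α ^ ((1 : ℝ) / 3) = β := by
    rw [hα, ← Real.rpow_natCast, ← Real.rpow_mul hβ0.le]
    norm_num
  have hα2 : α ^ ((2 : ℝ) / 3) = β ^ 2 := by
    rw [hα, ← Real.rpow_natCast, ← Real.rpow_mul hβ0.le, ← Real.rpow_natCast]
    norm_num
  rw [hα2] at hz hy
  rw [hα1] at hdB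
  have hβ1 : β ≤ 1 / 32 := by
    have : (1 : ℝ) * 1 ≤ t * (s + t) := by gcongr <;> linarith
    rw [hβ]
    gcongr
    linarith
  have hnR : (n : ℝ) = (2 * k + 1) * (s + t) := by rw [hn]; push_cast; ring
  have hk2 : (2 : ℝ) ≤ k := by exact_mod_cast hk
  have hn0 : (0 : ℝ) < n := by rw [hnR]; positivity
  have hA' : (A.card : ℝ) = k * (s + t) + z := by exact_mod_cast hA
  have hB' : (B.card : ℝ) = k * (s + t) + y := by exact_mod_cast hB
  obtain ⟨hz1, hz2⟩ := abs_le.1 hz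
  obtain ⟨hy1, hy2⟩ := abs_le.1 hy
  have ha : (n : ℝ) / 4 ≤ A.card := by
    have h1 : β ^ 2 * n / 2 ≤ n / 64 := by
      have : β ^ 2 ≤ (1 / 32) ^ 2 := by gcongr
      nlinarith
    have h2 : 2 * ((s : ℝ) + t) ≤ k * (s + t) := by gcongr
    linarith
  have hb : (B.card : ℝ) ≤ A.card + β ^ 2 * n := by linarith
  have hΔ : 0 ≤ β * n := by positivity
  have hzyR : (z : ℝ) ≤ y := by exact_mod_cast hzy
  have hd0 : 0 ≤ (y : ℝ) + s - (t : ℝ) / 2 - 1 := by linarith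
  obtain ⟨m, rfl⟩ : ∃ m : ℕ, y = m :=
    Int.eq_ofNat_of_zero_le (by
      have : (0 : ℝ) ≤ y := by linarith
      exact_mod_cast this)
  simp only [Int.cast_natCast] at *
  have hedges : ∀ X ⊆ A, ∀ U : Finset V, (X.card : ℝ) * (m + s - (t : ℝ) / 2 - 1) ≤
      ∑ a ∈ X, (degS F a (B \ U) : ℝ) + U.card * (β * n) := by
    intro X hX U
    refine le_trans ?_ (sum_degS_le_sum_sdiff_add F hΔ hX hdB)
    rw [← nsmul_eq_mul]
    exact card_nsmul_le_sum _ _ _ fun a ha => hdA a (hX ha)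
  have hcast : ∀ d : ℕ, d < s → (d : ℝ) ≤ s - 1 := by
    intro d hd
    have : (d : ℝ) + 1 ≤ s := by exact_mod_cast hd
    linarith
  obtain ⟨𝒮, h𝒮, hcard⟩ := exists_starFamily_of_forall_card_lt F s m B A (by
    intro W hW
    by_contra! hno
    have hWR : (W.card : ℝ) ≤ (s + 1) * m := by
      have : (W.card : ℝ) ≤ m * (s + 1) := by exact_mod_cast hW.le
      linarith
    have hsum : (∑ a ∈ A \ W, (degS F a (B \ W) : ℝ)) ≤ (s - 1) * B.card := by
      calc (∑ a ∈ A \ W, (degS F a (B \ W) : ℝ)) = ∑ b ∈ B \ W, (degS F b (A \ W) : ℝ) := by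
            exact_mod_cast sum_degS_comm F (A \ W) (B \ W)
        _ ≤ (B \ W).card • ((s : ℝ) - 1) :=
            sum_le_card_nsmul _ _ _ fun b hb => hcast _ (hno b hb)
        _ ≤ (s - 1) * B.card := by
            rw [nsmul_eq_mul, mul_comm]
            gcongr
            exact sdiff_subset
    have hX : (A.card : ℝ) - (s + 1) * m ≤ (A \ W).card := by
      have : (A.card : ℝ) ≤ (A \ W).card + W.card := by
        exact_mod_cast tsub_le_iff_right.1 (le_card_sdiff W A)
      linarith
    have h1 := hedges (A \ W) sdiff_subset W
    have h2 := mul_le_mul_of_nonneg_right hX hd0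
    have h3 := mul_le_mul_of_nonneg_right hWR hΔ
    have h4 := star_count_from_right hs1 ht1 hβ hn0 ha hb hy2 hyt
    linarith)
  refine ⟨𝒮, h𝒮, by exact_mod_cast hcard, fun hz0 => ?_⟩
  obtain ⟨l, rfl⟩ : ∃ l : ℕ, z = l := Int.eq_ofNat_of_zero_le (by omega)
  simp only [Int.cast_natCast, Nat.cast_inj] at *
  set L := 𝒮.biUnion fun S => S.2
  set C := 𝒮.image Prod.fst
  have hL : (L.card : ℝ) ≤ m * s := by
    rw [← hcard]
    exact_mod_cast card_biUnion_le_card_mul _ _ _ fun S hS => (h𝒮.1 S hS).2.2.1.le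
  have hC : (C.card : ℝ) ≤ m := by
    rw [← hcard]
    exact_mod_cast card_image_le
  refine exists_starFamily_of_forall_card_lt F s l (A \ L) (B \ C) ?_
  intro W hW
  by_contra! hno
  have hWR : (W.card : ℝ) ≤ (s + 1) * m := by
    have : (W.card : ℝ) ≤ l * (s + 1) := by exact_mod_cast hW.le
    nlinarith
  set X := (A \ L) \ W
  have hX : (A.card : ℝ) - (2 * s + 1) * m ≤ X.card := by
    have h1 : (A.card : ℝ) ≤ (A \ L).card + L.card := by
      exact_mod_cast tsub_le_iff_right.1 (le_card_sdiff L A)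
    have h2 : ((A \ L).card : ℝ) ≤ X.card + W.card := by
      exact_mod_cast tsub_le_iff_right.1 (le_card_sdiff W (A \ L))
    linarith
  have hU : ((C ∪ W).card : ℝ) ≤ (s + 2) * m := by
    have : ((C ∪ W).card : ℝ) ≤ C.card + W.card := by exact_mod_cast card_union_le C W
    linarith
  have hsum : (∑ a ∈ X, (degS F a (B \ (C ∪ W)) : ℝ)) ≤ X.card * (s - 1) := by
    rw [← nsmul_eq_mul]
    refine sum_le_card_nsmul _ _ _ fun a ha => hcast _ ?_
    have := hno a ha
    rwa [sdiff_sdiff_left] at this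
  have h1 := hedges X (sdiff_subset.trans sdiff_subset) (C ∪ W)
  have h2 := mul_le_mul_of_nonneg_right hX (show 0 ≤ (m : ℝ) - t / 2 by linarith)
  have h3 := mul_le_mul_of_nonneg_right hU hΔ
  have h4 := star_count_from_left hs1 ht1 hβ hn0 ha hy2 hyt
  linarith

end PaperTiling
end

section
/- Let 1 ≤ s < t be integers with t ≥ 2s+1, let α = (1/(32t(s+t)))³, and let n be sufficiently large. Let G be a bipartite graph with parts U and V, partitioned as U = U₀ ∪ U₁ ∪ U₂ and V = V₀ ∪ V₁ ∪ V₂, satisfying: s ≤ |U₀|, |V₀| ≤ α^{2/3} n; |U₁|, |U₂| ≤ (1 + α^{2/3}) n/2; every vertex of V₀ has at least (α^{1/3} − α^{2/3}) n/2 neighbors in U₁ and at least (α^{1/3} − α^{2/3}) n/2 neighbors in U₂. For i = 1,2 let Û_i = {u ∈ U_i : deg(u, V_{3−i}) < s}, and suppose |Û₁| ≥ n/8 and |Û₂| ≥ n/8, and that δ(Û₁, V₀) + δ(Û₂, V₀) ≥ |V₀| + s. Then G contains a copy of K_{s,t} with its s-side contained in V₀, ⌈t/2⌉ vertices of its t-side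 in U₁, and ⌊t/2⌋ vertices of its t-side in U₂. -/
open scoped Classical
open Finset

namespace PaperTiling

variable {V : Type*} [Fintype V] [DecidableEq V]

/-- Among `r * 2 ^ |W|` vertices, some `r` have the same neighbourhood inside `W`. -/
lemma exists_subset_same_nbhd {V : Type*} [DecidableEq V] (G : SimpleGraph V)
    (P W : Finset V) (r : ℕ)
    (h : r * 2 ^ W.card ≤ P.card) :
    ∃ T W' : Finset V, T ⊆ P ∧ T.card = r ∧ ∀ u ∈ T, (W.filter fun w => G.Adj u w) = W' := by
  obtain ⟨W', -, hW'⟩ := Finset.exists_le_card_fiber_of_mul_le_card_of_maps_to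
    (s := P) (t := W.powerset) (f := fun u => W.filter fun w => G.Adj u w) (n := r)
    (fun u _ => mem_powerset.2 (filter_subset _ _)) ⟨∅, empty_mem_powerset W⟩
    (by rw [card_powerset, mul_comm]; exact h)
  obtain ⟨T, hT, hTr⟩ := exists_subset_card_eq hW'
  exact ⟨T, W', fun u hu => (mem_filter.1 (hT hu)).1, hTr, fun u hu => (mem_filter.1 (hT hu)).2⟩

/-- Double counting the edges between two sets. -/
lemma sum_degS_comm_s13 {V : Type*} (G : SimpleGraph V) (W U : Finset V) :
    ∑ v ∈ W, degS G v U = ∑ u ∈ U, degS G u W := by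
  simp only [degS, card_filter]
  rw [sum_comm]
  simp only [G.adj_comm]

/-- If every vertex of `W` has at least `c * n` neighbours in a set `U` of size at most `n`, where
`W` is large in terms of `c, k, r` and `n` is large in terms of `|W|`, then some `r` vertices of
`U` have `k` common neighbours in `W`. -/
lemma exists_common_nbrs_of_dense (c : ℝ) (hc : 0 < c) (k r : ℕ) :
    ∃ K n₀ : ℕ, ∀ n : ℕ, n₀ ≤ n → ∀ (V : Type) (_ : Fintype V) (_ : DecidableEq V)
      (G : SimpleGraph V) (W U : Finset V), W.card = K → (U.card : ℝ) ≤ n →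
      (∀ v ∈ W, c * n ≤ (degS G v U : ℝ)) →
      ∃ T W' : Finset V, T ⊆ U ∧ T.card = r ∧ W' ⊆ W ∧ W'.card = k ∧
        ∀ w ∈ W', ∀ u ∈ T, G.Adj w u := by
  obtain ⟨K, hK⟩ := exists_nat_ge (2 * k / c)
  rw [div_le_iff₀ hc] at hK
  obtain ⟨n₀, hn₀⟩ := exists_nat_ge (2 * ((r + 1 : ℕ) * 2 ^ (K + 1) : ℝ) / c)
  rw [div_le_iff₀ hc] at hn₀
  refine ⟨K + 1, n₀, fun n hn V _ _ G W U hW hU hdeg => ?_⟩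
  set P := U.filter fun u => k ≤ degS G u W with hP
  have hcount : ((K + 1 : ℕ) : ℝ) * (c * n) ≤ P.card * (K + 1 : ℕ) + n * k := by
    calc ((K + 1 : ℕ) : ℝ) * (c * n) = ∑ _v ∈ W, c * n := by
          rw [sum_const, hW, nsmul_eq_mul]
      _ ≤ ∑ v ∈ W, (degS G v U : ℝ) := sum_le_sum hdeg
      _ = ((∑ u ∈ U, degS G u W : ℕ) : ℝ) := by rw [← sum_degS_comm_s13]; push_cast; rfl
      _ ≤ ((P.card * (K + 1) + U.card * k : ℕ) : ℝ) := by
          norm_cast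
          rw [← sum_filter_add_sum_filter_not U (fun u => k ≤ degS G u W)]
          refine add_le_add ?_ ?_
          · refine sum_le_card_nsmul _ _ _ fun u _ => ?_
            rw [← hW]
            exact card_filter_le _ _
          · refine (sum_le_card_nsmul _ _ k fun u hu => ?_).trans ?_
            · exact (not_le.1 (mem_filter.1 hu).2).le
            · exact Nat.mul_le_mul_right _ (card_filter_le _ _)
      _ ≤ _ := by
          push_cast
          gcongr
  have hn' : (n₀ : ℝ) ≤ n := by exact_mod_cast hn
  have hPc : c * n / 2 ≤ P.card := by
    have h2 : (k : ℝ) ≤ (K + 1 : ℕ) * (c / 2) := by push_cast; nlinarith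
    have h3 : (n : ℝ) * k ≤ n * ((K + 1 : ℕ) * (c / 2)) := by gcongr
    have h4 : (0 : ℝ) < (K + 1 : ℕ) := by positivity
    refine le_of_mul_le_mul_left ?_ h4
    linarith
  have hPr : (r + 1) * 2 ^ (K + 1) ≤ P.card := by
    have : ((r + 1 : ℕ) * 2 ^ (K + 1) : ℝ) ≤ P.card := by nlinarith
    exact_mod_cast this
  obtain ⟨T, W', hTP, hT, hTW⟩ := exists_subset_same_nbhd G P W (r + 1) (by rw [hW]; exact hPr)
  obtain ⟨u₀, hu₀⟩ : T.Nonempty := card_pos.1 (by omega)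
  have hk : k ≤ W'.card := by
    rw [← hTW u₀ hu₀]
    exact (mem_filter.1 (hTP hu₀)).2
  obtain ⟨W'', hW'', hk''⟩ := exists_subset_card_eq hk
  obtain ⟨T', hT', hr'⟩ := exists_subset_card_eq (show r ≤ T.card by omega)
  have hmem : ∀ u ∈ T, ∀ w ∈ W'', w ∈ W ∧ G.Adj u w := fun u hu w hw =>
    mem_filter.1 (by rw [hTW u hu]; exact hW'' hw)
  exact ⟨T', W'', fun u hu => (mem_filter.1 (hTP (hT' hu))).1, hr',
    fun w hw => (hmem u₀ hu₀ w hw).1, hk'', fun w hw u hu => (hmem u (hT' hu) w hw).2.symm⟩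

/-- If every `u₁ ∈ P₁` and `u₂ ∈ P₂` satisfy `deg(u₁, W) + deg(u₂, W) ≥ |W| + s`, and `P₁`, `P₂`
are large in terms of `|W|`, then `r₁` vertices of `P₁` and `r₂` vertices of `P₂` have `s` common
neighbours in `W`. -/
lemma exists_common_nbrs_of_add_degS {V : Type*} [DecidableEq V] (G : SimpleGraph V)
    (P₁ P₂ W : Finset V) (s r₁ r₂ : ℕ)
    (hr₁ : 0 < r₁) (hr₂ : 0 < r₂)
    (h₁ : r₁ * 2 ^ W.card ≤ P₁.card) (h₂ : r₂ * 2 ^ W.card ≤ P₂.card)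
    (h : ∀ u₁ ∈ P₁, ∀ u₂ ∈ P₂, W.card + s ≤ degS G u₁ W + degS G u₂ W) :
    ∃ S T₁ T₂ : Finset V, S ⊆ W ∧ S.card = s ∧ T₁ ⊆ P₁ ∧ T₁.card = r₁ ∧ T₂ ⊆ P₂ ∧ T₂.card = r₂ ∧
      (∀ w ∈ S, ∀ u ∈ T₁, G.Adj w u) ∧ ∀ w ∈ S, ∀ u ∈ T₂, G.Adj w u := by
  obtain ⟨T₁, W₁, hT₁, hc₁, hW₁⟩ := exists_subset_same_nbhd G P₁ W r₁ h₁
  obtain ⟨T₂, W₂, hT₂, hc₂, hW₂⟩ := exists_subset_same_nbhd G P₂ W r₂ h₂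
  obtain ⟨u₁, hu₁⟩ : T₁.Nonempty := card_pos.1 (by omega)
  obtain ⟨u₂, hu₂⟩ : T₂.Nonempty := card_pos.1 (by omega)
  have hsum : W.card + s ≤ W₁.card + W₂.card := by
    rw [← hW₁ u₁ hu₁, ← hW₂ u₂ hu₂]
    exact h u₁ (hT₁ hu₁) u₂ (hT₂ hu₂)
  have hsub₁ : W₁ ⊆ W := hW₁ u₁ hu₁ ▸ filter_subset _ _
  have hsub₂ : W₂ ⊆ W := hW₂ u₂ hu₂ ▸ filter_subset _ _
  have hinter : s ≤ (W₁ ∩ W₂).card := by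
    have := card_union_add_card_inter W₁ W₂
    have := card_le_card (union_subset hsub₁ hsub₂)
    omega
  obtain ⟨S, hS, hSs⟩ := exists_subset_card_eq hinter
  refine ⟨S, T₁, T₂, fun w hw => hsub₁ (mem_inter.1 (hS hw)).1, hSs, hT₁, hc₁, hT₂, hc₂,
    fun w hw u hu => ?_, fun w hw u hu => ?_⟩
  · have hw' := (mem_inter.1 (hS hw)).1
    rw [← hW₁ u hu] at hw'
    exact (mem_filter.1 hw').2.symm
  · have hw' := (mem_inter.1 (hS hw)).2
    rw [← hW₂ u hu] at hw'
    exact (mem_filter.1 hw').2.symm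

/-- Claim 2.6, K¹: under the stated degree and size conditions
on the partition `U = U₀ ∪ U₁ ∪ U₂`, `V = V₀ ∪ V₁ ∪ V₂`, the graph contains a
copy of `K_{s,t}` with its `s`-side in `V₀`, `⌈t/2⌉` vertices of its `t`-side
in `U₁` and `⌊t/2⌋` vertices of its `t`-side in `U₂`. -/
theorem claim_K1 (s t : ℕ) (hs : 1 ≤ s) (hst : s < t) (ht : 2 * s + 1 ≤ t)
    (α : ℝ) (hα : α = (1 / (32 * (t : ℝ) * ((s : ℝ) + (t : ℝ)))) ^ 3) :
    ∃ n₀ : ℕ, ∀ n : ℕ, n₀ ≤ n →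
    ∀ (V : Type) (_ : Fintype V) (_ : DecidableEq V),
    ∀ (G : SimpleGraph V) (A B : Finset V)
      (U0 U1 U2 V0 V1 V2 : Finset V),
      IsBipartition G A B →
      Disjoint U0 U1 → Disjoint U0 U2 → Disjoint U1 U2 → U0 ∪ U1 ∪ U2 = A →
      Disjoint V0 V1 → Disjoint V0 V2 → Disjoint V1 V2 → V0 ∪ V1 ∪ V2 = B →
      s ≤ U0.card → (U0.card : ℝ) ≤ α ^ ((2 : ℝ) / 3) * n →
      s ≤ V0.card → (V0.card : ℝ) ≤ α ^ ((2 : ℝ) / 3) * n →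
      (U1.card : ℝ) ≤ (1 + α ^ ((2 : ℝ) / 3)) * n / 2 →
      (U2.card : ℝ) ≤ (1 + α ^ ((2 : ℝ) / 3)) * n / 2 →
      (∀ v ∈ V0,
        (α ^ ((1 : ℝ) / 3) - α ^ ((2 : ℝ) / 3)) * n / 2 ≤ (degS G v U1 : ℝ)) →
      (∀ v ∈ V0,
        (α ^ ((1 : ℝ) / 3) - α ^ ((2 : ℝ) / 3)) * n / 2 ≤ (degS G v U2 : ℝ)) →
      ∀ Uh1 Uh2 : Finset V,
        Uh1 = U1.filter (fun u => degS G u V2 < s) →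
        Uh2 = U2.filter (fun u => degS G u V1 < s) →
        (n : ℝ) / 8 ≤ (Uh1.card : ℝ) → (n : ℝ) / 8 ≤ (Uh2.card : ℝ) →
        (∀ u1 ∈ Uh1, ∀ u2 ∈ Uh2,
          V0.card + s ≤ degS G u1 V0 + degS G u2 V0) →
        ∃ S T : Finset V, IsKst G s t S T ∧ S ⊆ V0 ∧ T ⊆ U1 ∪ U2 ∧
          (T ∩ U1).card = (t + 1) / 2 ∧ (T ∩ U2).card = t / 2 := by
  have ht₀ : (1 : ℝ) < 32 * (t : ℝ) * ((s : ℝ) + (t : ℝ)) := by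
    have h1 : (1 : ℝ) ≤ s := by exact_mod_cast hs
    have h2 : (1 : ℝ) ≤ t := by exact_mod_cast hs.trans hst.le
    nlinarith
  have hα0 : 0 < α := by rw [hα]; positivity
  have hα1 : α < 1 := by
    rw [hα]
    exact pow_lt_one₀ (by positivity) ((div_lt_one (by positivity)).2 ht₀) (by norm_num)
  have hlt : α ^ ((2 : ℝ) / 3) < α ^ ((1 : ℝ) / 3) :=
    Real.rpow_lt_rpow_of_exponent_gt hα0 hα1 (by norm_num)
  have hle : α ^ ((2 : ℝ) / 3) ≤ 1 := Real.rpow_le_one hα0.le hα1.le (by norm_num)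
  set b : ℝ := α ^ ((2 : ℝ) / 3)
  obtain ⟨c, hc⟩ : ∃ c : ℝ, c = (α ^ ((1 : ℝ) / 3) - b) / 2 := ⟨_, rfl⟩
  have hc0 : 0 < c := by rw [hc]; linarith
  obtain ⟨K₂, n₂, hK₂⟩ := exists_common_nbrs_of_dense c hc0 s (t / 2)
  obtain ⟨K₁, n₁, hK₁⟩ := exists_common_nbrs_of_dense c hc0 K₂ ((t + 1) / 2)
  refine ⟨max (max n₁ n₂) (8 * (t * 2 ^ K₁)), fun n hn V _ _ G A B U0 U1 U2 V0 V1 V2 hbip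
    _ _ hU12 hA _ _ _ hB _ _ _ _ hU1 hU2 hd1 hd2 Uh1 Uh2 hUh1 hUh2 hcard1 hcard2 hdeg => ?_⟩
  simp only [max_le_iff] at hn
  have hsub1 : Uh1 ⊆ U1 := hUh1 ▸ filter_subset _ _
  have hsub2 : Uh2 ⊆ U2 := hUh2 ▸ filter_subset _ _
  suffices hmain : ∃ S T₁ T₂ : Finset V, S ⊆ V0 ∧ S.card = s ∧ T₁ ⊆ U1 ∧ T₁.card = (t + 1) / 2 ∧
      T₂ ⊆ U2 ∧ T₂.card = t / 2 ∧
      (∀ w ∈ S, ∀ u ∈ T₁, G.Adj w u) ∧ ∀ w ∈ S, ∀ u ∈ T₂, G.Adj w u by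
    obtain ⟨S, T₁, T₂, hS, hSs, hT₁, hc₁, hT₂, hc₂, had₁, had₂⟩ := hmain
    have hTA : T₁ ∪ T₂ ⊆ U1 ∪ U2 := union_subset_union hT₁ hT₂
    have hi₁ : (T₁ ∪ T₂) ∩ U1 = T₁ := by
      rw [union_inter_distrib_right, inter_eq_left.2 hT₁,
        disjoint_iff_inter_eq_empty.1 (hU12.symm.mono_left hT₂), union_empty]
    have hi₂ : (T₁ ∪ T₂) ∩ U2 = T₂ := by
      rw [union_inter_distrib_right, inter_eq_left.2 hT₂,
        disjoint_iff_inter_eq_empty.1 (hU12.mono_left hT₁), empty_union]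
    refine ⟨S, T₁ ∪ T₂, ⟨?_, hSs, ?_, ?_⟩, hS, hTA, by rw [hi₁, hc₁], by rw [hi₂, hc₂]⟩
    · refine hbip.1.symm.mono (hS.trans ?_) (hTA.trans ?_)
      · rw [← hB]; intro x hx; simp [hx]
      · rw [← hA]; intro x hx; rcases mem_union.1 hx with h | h <;> simp [h]
    · rw [card_union_of_disjoint (hU12.mono hT₁ hT₂)]; omega
    · intro w hw u hu
      rcases mem_union.1 hu with h | h
      exacts [had₁ w hw u h, had₂ w hw u h]
  rcases le_or_gt K₁ V0.card with hV0 | hV0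
  · obtain ⟨W, hWV, hW⟩ := exists_subset_card_eq hV0
    have hn0 : (0 : ℝ) ≤ n := n.cast_nonneg
    obtain ⟨T₁, W', hT₁, hc₁, hW', hcW', had₁⟩ := hK₁ n hn.1.1 V inferInstance inferInstance G W U1 hW
        (by nlinarith) (fun v hv => (by rw [hc]; linarith [hd1 v (hWV hv)]))
    obtain ⟨T₂, S, hT₂, hc₂, hS, hSs, had₂⟩ := hK₂ n hn.1.2 V inferInstance inferInstance G W' U2 hcW'
        (by nlinarith) (fun v hv => (by rw [hc]; linarith [hd2 v (hWV (hW' hv))]))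
    exact ⟨S, T₁, T₂, hS.trans (hW'.trans hWV), hSs, hT₁, hc₁, hT₂, hc₂,
      fun w hw => had₁ w (hS hw), had₂⟩
  · have hpow : t * 2 ^ V0.card ≤ t * 2 ^ K₁ := by gcongr; norm_num
    have hlarge : ∀ P : Finset V, (n : ℝ) / 8 ≤ P.card → ∀ r ≤ t, r * 2 ^ V0.card ≤ P.card := by
      intro P hP r hr
      have h8 : n ≤ 8 * P.card := by
        have : (n : ℝ) ≤ 8 * P.card := by linarith
        exact_mod_cast this
      have := Nat.mul_le_mul_right (2 ^ V0.card) hr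
      omega
    obtain ⟨S, T₁, T₂, hS, hSs, hT₁, hc₁, hT₂, hc₂, had₁, had₂⟩ :=
      exists_common_nbrs_of_add_degS G Uh1 Uh2 V0 s ((t + 1) / 2) (t / 2) (by omega) (by omega)
        (hlarge _ hcard1 _ (by omega)) (hlarge _ hcard2 _ (by omega)) hdeg
    exact ⟨S, T₁, T₂, hS, hSs, hT₁.trans hsub1, hc₁, hT₂.trans hsub2, hc₂, had₁, had₂⟩

end PaperTiling
end

section
/- For every positive integer p there exists m₀ such that for every integer m > m₀ there exists a balanced bipartite graph P(m,p) on 2m vertices such that (1) P(m,p) is p-regular and (2) P(m,p) does not contain a copy of K_{2,2}. -/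
open scoped Classical
open Finset

namespace PaperTiling

variable {V : Type*} [Fintype V] [DecidableEq V]

/-- The bipartite Cayley graph of an additive group `R` with connection set `D`: the vertex `u`
of the left copy of `R` is adjacent to the vertex `v` of the right copy when `v - u ∈ D`. -/
def biCayley {R : Type*} [AddCommGroup R] (D : Finset R) : SimpleGraph (R ⊕ R) where
  Adj
    | .inl u, .inr v => v - u ∈ D
    | .inr v, .inl u => v - u ∈ D
    | .inl _, .inl _ => False
    | .inr _, .inr _ => False
  symm := ⟨by rintro (u | u) (v | v) h <;> exact h⟩
  loopless := ⟨by rintro (u | u) h <;> exact h⟩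

section biCayley

variable {R : Type*} [AddCommGroup R] (D : Finset R)

@[simp] theorem biCayley_inl_inr (u v : R) :
    (biCayley D).Adj (.inl u) (.inr v) ↔ v - u ∈ D := Iff.rfl

@[simp] theorem biCayley_inr_inl (u v : R) :
    (biCayley D).Adj (.inr v) (.inl u) ↔ v - u ∈ D := Iff.rfl

@[simp] theorem biCayley_inl_inl (u v : R) : ¬ (biCayley D).Adj (.inl u) (.inl v) := id

@[simp] theorem biCayley_inr_inr (u v : R) : ¬ (biCayley D).Adj (.inr u) (.inr v) := id

/-- The bipartite Cayley graph of a Sidon set has no four-cycle. -/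
theorem biCayley_eq_or_eq
    (hD : ∀ a ∈ D, ∀ b ∈ D, ∀ c ∈ D, ∀ d ∈ D, a + d = b + c → a = b ∨ a = c)
    {x y z w : R ⊕ R} (hxz : (biCayley D).Adj x z) (hxw : (biCayley D).Adj x w)
    (hyz : (biCayley D).Adj y z) (hyw : (biCayley D).Adj y w) : x = y ∨ z = w := by
  rcases x with x | x <;> rcases y with y | y <;> rcases z with z | z <;>
    rcases w with w | w <;> simp at hxz hxw hyz hyw
  · rcases hD _ hxz _ hyz _ hxw _ hyw (by abel) with h | h
    · left; simpa using h
    · right; simpa using h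
  · rcases hD _ hxz _ hyz _ hxw _ hyw (by abel) with h | h
    · left; simpa using h
    · right; simpa using h

theorem degS_comap_biCayley {V : Type*} [Fintype V] (e : V ≃ R ⊕ R) (v : V) :
    degS ((biCayley D).comap e) v Finset.univ = D.card := by
  unfold degS
  rcases hv : e v with u | u
  · rw [← Finset.card_image_of_injective D
      (f := fun d => e.symm (.inr (u + d))) (fun a b h => by simpa using h)]
    congr 1
    ext w
    obtain ⟨w, rfl⟩ := e.symm.surjective w
    rcases w with w | w
    · simp [hv]
    · simp only [Finset.mem_filter, Finset.mem_univ, true_and, SimpleGraph.comap_adj, hv,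
        Equiv.apply_symm_apply, biCayley_inl_inr, Finset.mem_image, EmbeddingLike.apply_eq_iff_eq,
        Sum.inr.injEq]
      exact ⟨fun h => ⟨_, h, by abel⟩, by rintro ⟨d, hd, rfl⟩; simpa using hd⟩
  · rw [← Finset.card_image_of_injective D
      (f := fun d => e.symm (.inl (u - d))) (fun a b h => by simpa using h)]
    congr 1
    ext w
    obtain ⟨w, rfl⟩ := e.symm.surjective w
    rcases w with w | w
    · simp only [Finset.mem_filter, Finset.mem_univ, true_and, SimpleGraph.comap_adj, hv,
        Equiv.apply_symm_apply, biCayley_inr_inl, Finset.mem_image, EmbeddingLike.apply_eq_iff_eq,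
        Sum.inl.injEq]
      exact ⟨fun h => ⟨_, h, by abel⟩, by rintro ⟨d, hd, rfl⟩; simpa using hd⟩
    · simp [hv]

end biCayley

/-- The powers of two form a Sidon set. -/
theorem two_pow_add_two_pow_eq {a b c d : ℕ} (h : 2 ^ a + 2 ^ d = 2 ^ b + 2 ^ c) :
    a = b ∨ a = c := by
  induction a generalizing b c d with
  | zero =>
    rcases b with _ | b
    · simp
    rcases c with _ | c
    · simp
    have hb := Nat.two_pow_pos b
    have hc := Nat.two_pow_pos c
    rcases d with _ | d <;> simp only [pow_succ, pow_zero] at h <;> omega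
  | succ a ih =>
    rcases d with _ | d <;> rcases b with _ | b <;> rcases c with _ | c
    case succ.succ.succ =>
      have := ih (b := b) (c := c) (d := d) (by simp only [pow_succ] at h; omega)
      omega
    case zero.zero.succ =>
      right; exact Nat.pow_right_injective le_rfl (show 2 ^ (a + 1) = 2 ^ (c + 1) by omega)
    case zero.succ.zero =>
      left; exact Nat.pow_right_injective le_rfl (show 2 ^ (a + 1) = 2 ^ (b + 1) by omega)
    case succ.zero.zero =>
      have ha := Nat.two_pow_pos a
      have hd := Nat.two_pow_pos d
      simp only [pow_succ, pow_zero] at h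
      omega
    all_goals
      have ha := Nat.two_pow_pos a
      simp only [pow_succ, pow_zero] at h
      omega

/-- Lemma 3.1: for every `p ≥ 1` and every sufficiently large
`m` there is a `p`-regular balanced bipartite graph `P(m,p)` on `2m` vertices
containing no copy of `K_{2,2}`. -/
theorem exists_Pmp (p : ℕ) (hp : 1 ≤ p) :
    ∃ m₀ : ℕ, ∀ m : ℕ, m₀ < m →
      ∃ (G : SimpleGraph (Fin (2 * m))) (A B : Finset (Fin (2 * m))),
        IsBipartition G A B ∧ A.card = m ∧ B.card = m ∧
        (∀ v : Fin (2 * m), degS G v Finset.univ = p) ∧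
        ∀ S T : Finset (Fin (2 * m)), ¬ IsKst G 2 2 S T := by
  refine ⟨2 ^ (p + 1), fun m hm => ?_⟩
  have : NeZero m := ⟨(Nat.zero_lt_of_lt hm).ne'⟩
  have hlt {i : ℕ} (hi : i < p) : 2 * 2 ^ i < m := by
    have := Nat.pow_le_pow_right (n := 2) (by norm_num) hi
    have := Nat.two_pow_pos p
    rw [pow_succ] at *
    omega
  have hcast {x y : ℕ} (hx : x < m) (hy : y < m) (h : (x : ZMod m) = y) : x = y :=
    Nat.ModEq.eq_of_lt_of_lt ((ZMod.natCast_eq_natCast_iff _ _ _).1 h) hx hy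
  let D : Finset (ZMod m) := (Finset.range p).image fun i => ((2 ^ i : ℕ) : ZMod m)
  have hcard : D.card = p := by
    refine (Finset.card_image_of_injOn ?_).trans (Finset.card_range p)
    intro i hi j hj h
    have hi := hlt (Finset.mem_range.1 hi)
    have hj := hlt (Finset.mem_range.1 hj)
    exact Nat.pow_right_injective le_rfl
      (hcast (x := 2 ^ i) (y := 2 ^ j) (by omega) (by omega) h)
  have hD : ∀ a ∈ D, ∀ b ∈ D, ∀ c ∈ D, ∀ d ∈ D, a + d = b + c → a = b ∨ a = c := by
    simp only [D, Finset.forall_mem_image, Finset.mem_range]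
    intro a ha b hb c hc d hd h
    have ha := hlt ha
    have hb := hlt hb
    have hc := hlt hc
    have hd := hlt hd
    rw [← Nat.cast_add, ← Nat.cast_add] at h
    rcases two_pow_add_two_pow_eq (hcast (by omega) (by omega) h) with rfl | rfl <;> simp
  let e : Fin (2 * m) ≃ ZMod m ⊕ ZMod m := Fintype.equivOfCardEq (by simp [ZMod.card, two_mul])
  refine ⟨(biCayley D).comap e,
    Finset.univ.map (Function.Embedding.inl.trans e.symm.toEmbedding),
    Finset.univ.map (Function.Embedding.inr.trans e.symm.toEmbedding),
    ⟨?_, ?_, ?_⟩, by simp [ZMod.card], by simp [ZMod.card],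
    fun v => (degS_comap_biCayley D e v).trans hcard, ?_⟩
  · simp [Finset.disjoint_left]
  · ext x
    obtain ⟨x, rfl⟩ := e.symm.surjective x
    rcases x with x | x <;> simp
  · intro u v
    obtain ⟨u, rfl⟩ := e.symm.surjective u
    obtain ⟨v, rfl⟩ := e.symm.surjective v
    rcases u with u | u <;> rcases v with v | v <;> simp
  · rintro S T ⟨-, hS, hT, h⟩
    obtain ⟨x, y, hxy, rfl⟩ := Finset.card_eq_two.1 hS
    obtain ⟨z, w, hzw, rfl⟩ := Finset.card_eq_two.1 hT
    rcases biCayley_eq_or_eq D hD (h x (by simp) z (by simp)) (h x (by simp) w (by simp))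
      (h y (by simp) z (by simp)) (h y (by simp) w (by simp)) with h | h
    · exact hxy (e.injective h)
    · exact hzw (e.injective h)

end PaperTiling
end

section
/- Assume the structure hypotheses (H). If K is a crossing copy of K_{s,t} in G, then: (1) V(K) intersects some member of 𝒲 = {U₁, U₂, V₁, V₂} in exactly one vertex; (2) there is exactly one A₀ ∈ {U₀, V₀} with V(K) ∩ A₀ ≠ ∅; moreover, if |V(K) ∩ A| = 1 for some A ∈ 𝒲, then (3) V(K) ∩ A^D ≠ ∅, and (4) either |V(K) ∩ A^N| ≥ 2 and V(K) ∩ (A^N)^D = ∅, or V(K) ∩ A^N = ∅ and |V(K) ∩ (A^N)^D| ≥ 2. -/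
open scoped Classical
open Finset

namespace PaperTiling

variable {V : Type*} [Fintype V] [DecidableEq V]

/-- The `s`-side and the `t`-side of a copy of `K_{s,t}` lie in different parts of a bipartition. -/
lemma IsKst.subset_parts {V : Type*} [Fintype V] [DecidableEq V] {G : SimpleGraph V}
    {s t : ℕ} {S T A B : Finset V} (hK : IsKst G s t S T) (hG : IsBipartition G A B)
    (hs : 1 ≤ s) (ht : 1 ≤ t) : (S ⊆ A ∧ T ⊆ B) ∨ (S ⊆ B ∧ T ⊆ A) := by
  obtain ⟨-, hS, hT, hadj⟩ := hK
  obtain ⟨hAB, -, hE⟩ := hG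
  have hd : ∀ v, v ∈ A → v ∉ B := fun v h => Finset.disjoint_left.mp hAB h
  obtain ⟨a, ha⟩ : S.Nonempty := Finset.card_pos.mp (by omega)
  obtain ⟨b, hb⟩ : T.Nonempty := Finset.card_pos.mp (by omega)
  rcases hE a b (hadj a ha b hb) with h | h
  · exact Or.inl ⟨fun x hx => by grind [hE x b (hadj x hx b hb)],
      fun y hy => by grind [hE a y (hadj a ha y hy)]⟩
  · exact Or.inr ⟨fun x hx => by grind [hE x b (hadj x hx b hb)],
      fun y hy => by grind [hE a y (hadj a ha y hy)]⟩

/-- If `X` meets `A` and `X` is completely joined to `Y`, then `|Y ∩ B|` is at most any bound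
on the degrees into `B` of the vertices of `A`. -/
lemma card_inter_le_of_degS_le {V : Type*} [Fintype V] [DecidableEq V] {G : SimpleGraph V}
    {X Y A B : Finset V} {d : ℕ} (hadj : ∀ x ∈ X, ∀ y ∈ Y, G.Adj x y)
    (hdeg : ∀ a ∈ A, degS G a B ≤ d) (h : 1 ≤ (X ∩ A).card) : (Y ∩ B).card ≤ d := by
  obtain ⟨a, ha⟩ := Finset.card_pos.mp h
  rw [Finset.mem_inter] at ha
  refine le_trans (Finset.card_le_card fun y hy => ?_) (hdeg a ha.2)
  rw [Finset.mem_inter] at hy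
  exact Finset.mem_filter.mpr ⟨hy.2, hadj a ha.1 y hy.1⟩

/-- A complete pair `(X, Y)` has at most one vertex on one side of a `K_{2,2}`-free pair. -/
lemma card_inter_le_one_of_K22free {V : Type*} [Fintype V] [DecidableEq V] {G : SimpleGraph V}
    {X Y A B : Finset V} (hadj : ∀ x ∈ X, ∀ y ∈ Y, G.Adj x y)
    (hfree : ∀ S T : Finset V, S ⊆ A → T ⊆ B → ¬ IsKst G 2 2 S T) :
    (X ∩ A).card ≤ 1 ∨ (Y ∩ B).card ≤ 1 := by
  by_contra! h
  obtain ⟨P, hP, hPc⟩ := Finset.exists_subset_card_eq (show 2 ≤ (X ∩ A).card from h.1)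
  obtain ⟨Q, hQ, hQc⟩ := Finset.exists_subset_card_eq (show 2 ≤ (Y ∩ B).card from h.2)
  have hPQ : ∀ u ∈ P, ∀ v ∈ Q, G.Adj u v := fun u hu v hv =>
    hadj u (Finset.mem_inter.mp (hP hu)).1 v (Finset.mem_inter.mp (hQ hv)).1
  exact hfree P Q (fun x hx => (Finset.mem_inter.mp (hP hx)).2)
    (fun x hx => (Finset.mem_inter.mp (hQ hx)).2)
    ⟨Finset.disjoint_left.mpr fun x hx hx' => (hPQ x hx x hx').ne rfl, hPc, hQc, hPQ⟩

/-- A subset of a disjoint union of three sets is counted by its three intersections. -/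
lemma card_eq_of_subset_union {V : Type*} [DecidableEq V] {X A B C : Finset V}
    (h : X ⊆ A ∪ B ∪ C) (hAB : Disjoint A B) (hAC : Disjoint A C) (hBC : Disjoint B C) :
    X.card = (X ∩ A).card + (X ∩ B).card + (X ∩ C).card := by
  rw [← Finset.card_union_of_disjoint (hAB.mono Finset.inter_subset_right Finset.inter_subset_right),
    ← Finset.card_union_of_disjoint, ← Finset.inter_union_distrib_left,
    ← Finset.inter_union_distrib_left, Finset.inter_eq_left.mpr h]
  rw [← Finset.inter_union_distrib_left]
  exact (Finset.disjoint_union_left.mpr ⟨hAC, hBC⟩).mono Finset.inter_subset_right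
    Finset.inter_subset_right

/-- The numbers of vertices of a crossing copy in the six parts, when the side of size `s` has
`xᵢ` vertices in the part `i` of its class and the side of size `t` has `yᵢ`. -/
lemma crossing_counts {s t x0 x1 x2 y0 y1 y2 : ℕ} (ht : 2 * s + 1 ≤ t) (hs : 1 ≤ s)
    (hx : s = x0 + x1 + x2) (hy : t = y0 + y1 + y2)
    (hx0 : x0 ≤ s - 1) (hy0 : y0 ≤ s - 1) (h00 : x0 = 0 ∨ y0 = 0)
    (hc1 : 1 ≤ x1 ∨ 1 ≤ y1) (hc2 : 1 ≤ x2 ∨ 1 ≤ y2)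
    (hd1 : 1 ≤ x1 → y2 ≤ s - 1) (hd2 : 1 ≤ x2 → y1 ≤ s - 1)
    (hd3 : 1 ≤ y1 → x2 ≤ s - 1) (hd4 : 1 ≤ y2 → x1 ≤ s - 1)
    (hf1 : x1 ≤ 1 ∨ y2 ≤ 1) (hf2 : x2 ≤ 1 ∨ y1 ≤ 1) :
    (x1 = 1 ∨ x2 = 1 ∨ y1 = 1 ∨ y2 = 1) ∧
    (0 < x0 ∧ y0 = 0 ∨ 0 < y0 ∧ x0 = 0) ∧
    (x1 = 1 → 0 < y2 ∧ (2 ≤ y1 ∧ x2 = 0 ∨ y1 = 0 ∧ 2 ≤ x2)) ∧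
    (x2 = 1 → 0 < y1 ∧ (2 ≤ y2 ∧ x1 = 0 ∨ y2 = 0 ∧ 2 ≤ x1)) ∧
    (y1 = 1 → 0 < x2 ∧ (2 ≤ x1 ∧ y2 = 0 ∨ x1 = 0 ∧ 2 ≤ y2)) ∧
    (y2 = 1 → 0 < x1 ∧ (2 ≤ x2 ∧ y1 = 0 ∨ x2 = 0 ∧ 2 ≤ y1)) := by
  have h12 : x1 = 0 ∨ x2 = 0 := by omega
  rcases h12 with rfl | rfl <;> refine ⟨?_, ?_, ?_, ?_, ?_, ?_⟩ <;> omega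

/-- Claim 3.2, properties of crossing copies: under the
structure hypotheses (H), any crossing copy `K` of `K_{s,t}` with vertex set
`W` satisfies: (1) `W` meets some member of `𝒲 = {U₁,U₂,V₁,V₂}` in exactly
one vertex; (2) exactly one of `U₀`, `V₀` meets `W`; and if `|W ∩ A| = 1` for
`A ∈ 𝒲` then (3) `W ∩ A^D ≠ ∅` and (4) either `|W ∩ A^N| ≥ 2` and
`W ∩ (A^N)^D = ∅`, or `W ∩ A^N = ∅` and `|W ∩ (A^N)^D| ≥ 2`. -/
theorem claim_properties {V : Type*} [Fintype V] [DecidableEq V]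
    (G : SimpleGraph V) (s t k : ℕ) (U0 U1 U2 V0 V1 V2 : Finset V)
    (hH : StructH G s t k U0 U1 U2 V0 V1 V2)
    (S T : Finset V) (hK : IsKst G s t S T)
    (W : Finset V) (hW : W = S ∪ T)
    (hcross : Crossing U1 V1 U2 V2 W) :
    ((W ∩ U1).card = 1 ∨ (W ∩ U2).card = 1 ∨
      (W ∩ V1).card = 1 ∨ (W ∩ V2).card = 1) ∧
    (((W ∩ U0).Nonempty ∧ W ∩ V0 = ∅) ∨
      ((W ∩ V0).Nonempty ∧ W ∩ U0 = ∅)) ∧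
    (∀ A AD AN AND : Finset V,
      ((A, AD, AN, AND) = (U1, V2, V1, U2) ∨
       (A, AD, AN, AND) = (U2, V1, V2, U1) ∨
       (A, AD, AN, AND) = (V1, U2, U1, V2) ∨
       (A, AD, AN, AND) = (V2, U1, U2, V1)) →
      (W ∩ A).card = 1 →
      (W ∩ AD).Nonempty ∧
        ((2 ≤ (W ∩ AN).card ∧ W ∩ AND = ∅) ∨
         (W ∩ AN = ∅ ∧ 2 ≤ (W ∩ AND).card))) := by
  obtain ⟨X, Y, hX, hY, hadj, hXY, hWXY⟩ : ∃ X Y : Finset V,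
      X ⊆ U0 ∪ U1 ∪ U2 ∧ Y ⊆ V0 ∪ V1 ∪ V2 ∧ (∀ x ∈ X, ∀ y ∈ Y, G.Adj x y) ∧
      ((X.card = s ∧ Y.card = t) ∨ (X.card = t ∧ Y.card = s)) ∧ W = X ∪ Y := by
    rcases hK.subset_parts hH.bip hH.hs (by have := hH.ht; omega) with h | h
    · exact ⟨S, T, h.1, h.2, hK.2.2.2, Or.inl ⟨hK.2.1, hK.2.2.1⟩, hW⟩
    · exact ⟨T, S, h.2, h.1, fun x hx y hy => (hK.2.2.2 y hy x hx).symm,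
        Or.inr ⟨hK.2.2.1, hK.2.1⟩, hW.trans (Finset.union_comm _ _)⟩
  have hadj' : ∀ y ∈ Y, ∀ x ∈ X, G.Adj y x := fun y hy x hx => (hadj x hx y hy).symm
  have hU : ∀ A ⊆ U0 ∪ U1 ∪ U2, W ∩ A = X ∩ A := fun A hA => by
    rw [hWXY, Finset.union_inter_distrib_right,
      Finset.disjoint_iff_inter_eq_empty.mp (hH.bip.1.symm.mono hY hA), Finset.union_empty]
  have hV : ∀ A ⊆ V0 ∪ V1 ∪ V2, W ∩ A = Y ∩ A := fun A hA => by
    rw [hWXY, Finset.union_inter_distrib_right,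
      Finset.disjoint_iff_inter_eq_empty.mp (hH.bip.1.mono hX hA), Finset.empty_union]
  have eU0 := hU U0 (Finset.subset_union_left.trans Finset.subset_union_left)
  have eU1 := hU U1 (Finset.subset_union_right.trans Finset.subset_union_left)
  have eU2 := hU U2 Finset.subset_union_right
  have eV0 := hV V0 (Finset.subset_union_left.trans Finset.subset_union_left)
  have eV1 := hV V1 (Finset.subset_union_right.trans Finset.subset_union_left)
  have eV2 := hV V2 Finset.subset_union_right
  have hc1 : 1 ≤ (X ∩ U1).card ∨ 1 ≤ (Y ∩ V1).card := by
    have h := hcross.1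
    rw [Finset.inter_union_distrib_left, eU1, eV1, Finset.union_nonempty] at h
    exact h.imp Finset.card_pos.mpr Finset.card_pos.mpr
  have hc2 : 1 ≤ (X ∩ U2).card ∨ 1 ≤ (Y ∩ V2).card := by
    have h := hcross.2
    rw [Finset.inter_union_distrib_left, eU2, eV2, Finset.union_nonempty] at h
    exact h.imp Finset.card_pos.mpr Finset.card_pos.mpr
  have hXc := card_eq_of_subset_union hX hH.hU01 hH.hU02 hH.hU12
  have hYc := card_eq_of_subset_union hY hH.hV01 hH.hV02 hH.hV12
  have hd1 := card_inter_le_of_degS_le hadj hH.degU1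
  have hd2 := card_inter_le_of_degS_le hadj hH.degU2
  have hd3 := card_inter_le_of_degS_le hadj' hH.degV1
  have hd4 := card_inter_le_of_degS_le hadj' hH.degV2
  have hf1 := card_inter_le_one_of_K22free hadj hH.K22freeU1V2
  have hf2 := card_inter_le_one_of_K22free hadj hH.K22freeU2V1
  have hx0 : (X ∩ U0).card ≤ s - 1 :=
    hH.cardU0 ▸ Finset.card_le_card Finset.inter_subset_right
  have hy0 : (Y ∩ V0).card ≤ s - 1 :=
    hH.cardV0 ▸ Finset.card_le_card Finset.inter_subset_right
  have h00 : (X ∩ U0).card = 0 ∨ (Y ∩ V0).card = 0 := by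
    by_contra! h
    obtain ⟨u, hu⟩ := Finset.card_pos.mp (Nat.pos_of_ne_zero h.1)
    obtain ⟨v, hv⟩ := Finset.card_pos.mp (Nat.pos_of_ne_zero h.2)
    rw [Finset.mem_inter] at hu hv
    exact hH.emptyU0V0 u hu.2 v hv.2 (hadj u hu.1 v hv.1)
  obtain ⟨h1, h2, h3, h4, h5, h6⟩ :
      ((X ∩ U1).card = 1 ∨ (X ∩ U2).card = 1 ∨ (Y ∩ V1).card = 1 ∨ (Y ∩ V2).card = 1) ∧
      (0 < (X ∩ U0).card ∧ (Y ∩ V0).card = 0 ∨ 0 < (Y ∩ V0).card ∧ (X ∩ U0).card = 0) ∧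
      ((X ∩ U1).card = 1 → 0 < (Y ∩ V2).card ∧
        (2 ≤ (Y ∩ V1).card ∧ (X ∩ U2).card = 0 ∨ (Y ∩ V1).card = 0 ∧ 2 ≤ (X ∩ U2).card)) ∧
      ((X ∩ U2).card = 1 → 0 < (Y ∩ V1).card ∧
        (2 ≤ (Y ∩ V2).card ∧ (X ∩ U1).card = 0 ∨ (Y ∩ V2).card = 0 ∧ 2 ≤ (X ∩ U1).card)) ∧
      ((Y ∩ V1).card = 1 → 0 < (X ∩ U2).card ∧
        (2 ≤ (X ∩ U1).card ∧ (Y ∩ V2).card = 0 ∨ (X ∩ U1).card = 0 ∧ 2 ≤ (Y ∩ V2).card)) ∧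
      ((Y ∩ V2).card = 1 → 0 < (X ∩ U1).card ∧
        (2 ≤ (X ∩ U2).card ∧ (Y ∩ V1).card = 0 ∨ (X ∩ U2).card = 0 ∧ 2 ≤ (Y ∩ V1).card)) := by
    rcases hXY with ⟨hXs, hYt⟩ | ⟨hXt, hYs⟩
    · exact crossing_counts hH.ht hH.hs (hXs ▸ hXc) (hYt ▸ hYc) hx0 hy0 h00 hc1 hc2
        hd1 hd2 hd3 hd4 hf1 hf2
    · obtain ⟨h1, h2, h3, h4, h5, h6⟩ := crossing_counts hH.ht hH.hs (hYs ▸ hYc) (hXt ▸ hXc)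
        hy0 hx0 h00.symm hc1.symm hc2.symm hd3 hd4 hd1 hd2 hf2.symm hf1.symm
      exact ⟨or_assoc.mp (or_comm.mp (or_assoc.mpr h1)), h2.symm, h5, h6, h3, h4⟩
  simp only [← eU0, ← eU1, ← eU2, ← eV0, ← eV1, ← eV2, Finset.card_pos,
    Finset.card_eq_zero] at h1 h2 h3 h4 h5 h6
  refine ⟨h1, h2, ?_⟩
  rintro A AD AN AND h hA
  simp only [Prod.mk.injEq] at h
  rcases h with ⟨rfl, rfl, rfl, rfl⟩ | ⟨rfl, rfl, rfl, rfl⟩ | ⟨rfl, rfl, rfl, rfl⟩ |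
    ⟨rfl, rfl, rfl, rfl⟩
  · exact h3 hA
  · exact h4 hA
  · exact h5 hA
  · exact h6 hA

end PaperTiling
end

section
/- Let s < t be positive integers with t ≥ 2s+1 and let k be a nonnegative integer. Suppose x and y are integers for which there exist nonnegative integers ℓ, a, b with x = ℓ(s+t) + as + bt and y = ℓ(s+t) + at + bs, and suppose x > k(s+t) + s and y > k(s+t) + s. Then either max{x, y} ≥ k(s+t) + 2t, or min{x, y} ≥ (k+1)(s+t). -/
open scoped Classical
open Finset

namespace PaperTiling

variable {V : Type*} [Fintype V] [DecidableEq V]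

/-- The case of `tiling_arithmetic` in which `d` copies of `K_{s,t}` remain after pairing up
copies of opposite orientation: the first part is the smaller one. -/
theorem add_two_mul_le_or_succ_mul_le {s t k m d : ℕ} (ht : 2 * s + 1 ≤ t)
    (hx : k * (s + t) + s < m * (s + t) + d * s) :
    k * (s + t) + 2 * t ≤ m * (s + t) + d * t ∨
      (k + 1) * (s + t) ≤ m * (s + t) + d * s := by
  rcases Nat.lt_or_ge k m with hkm | hmk
  · right
    have := Nat.mul_le_mul_right (s + t) (Nat.succ_le_of_lt hkm)
    exact this.trans (Nat.le_add_right _ _)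
  · left
    obtain ⟨j, rfl⟩ := Nat.exists_eq_add_of_le hmk
    have hd : 3 * j + 1 < d := by
      by_contra! h
      nlinarith [Nat.mul_le_mul_right s h, Nat.mul_le_mul_left j ht]
    have hdt : (3 * j + 2) * t ≤ d * t := Nat.mul_le_mul_right t hd
    have hjs : j * s ≤ j * t := Nat.mul_le_mul_left j (by lia)
    nlinarith

/-- arithmetic core of Claim 3.5: if `x = ℓ(s+t)+as+bt` and
`y = ℓ(s+t)+at+bs` for some nonnegative integers `ℓ, a, b`, and both exceed
`k(s+t)+s`, then `max{x,y} ≥ k(s+t)+2t` or `min{x,y} ≥ (k+1)(s+t)`. -/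
theorem tiling_arithmetic (s t k x y : ℕ) (hs : 1 ≤ s) (hst : s < t)
    (ht : 2 * s + 1 ≤ t)
    (hxy : ∃ ℓ a b : ℕ,
      x = ℓ * (s + t) + a * s + b * t ∧ y = ℓ * (s + t) + a * t + b * s)
    (hx : k * (s + t) + s < x) (hy : k * (s + t) + s < y) :
    k * (s + t) + 2 * t ≤ max x y ∨ (k + 1) * (s + t) ≤ min x y := by
  obtain ⟨ℓ, a, b, rfl, rfl⟩ := hxy
  rcases le_total b a with h | h
  · obtain ⟨d, rfl⟩ := Nat.exists_eq_add_of_le h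
    have ex : ℓ * (s + t) + (b + d) * s + b * t = (ℓ + b) * (s + t) + d * s := by ring
    have ey : ℓ * (s + t) + (b + d) * t + b * s = (ℓ + b) * (s + t) + d * t := by ring
    have hd : d * s ≤ d * t := Nat.mul_le_mul_left d hst.le
    rw [ex] at hx ⊢
    rw [ey, max_eq_right (by lia), min_eq_left (by lia)]
    exact add_two_mul_le_or_succ_mul_le ht hx
  · obtain ⟨d, rfl⟩ := Nat.exists_eq_add_of_le h
    have ex : ℓ * (s + t) + a * s + (a + d) * t = (ℓ + a) * (s + t) + d * t := by ring
    have ey : ℓ * (s + t) + a * t + (a + d) * s = (ℓ + a) * (s + t) + d * s := by ring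
    have hd : d * s ≤ d * t := Nat.mul_le_mul_left d hst.le
    rw [ey] at hy ⊢
    rw [ex, max_eq_left (by lia), min_eq_right (by lia)]
    exact add_two_mul_le_or_succ_mul_le ht hy

end PaperTiling
end
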